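/- Let λ > 0 and γ ∈ ℝ. Let g : (0,∞) → [0,∞) be measurable with ∫₀¹ g(x) dx < ∞ and ∫₀^∞ g(x)·e^{-λx} dx > 0, and suppose that g(x) = e^{-λx}·x^{-γ}·L₁(x) for all x > 1, where L₁ : (0,∞) → ℝ is slowly varying at infinity and bounded away from 0 and ∞ on every interval of the form [1, T]. Then, as h → ∞, ∫₀^∞ g(x)·g(x+h) dx is asymptotically equivalent to (∫₀^∞ g(x)·e^{-λx} dx) · e^{-λh} · h^{-γ} · L₁(h), i.e. the ratio of the two sides tends to 1. -/

import Mathlib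

open MeasureTheory Set Filter

/-- Uniform convergence theorem for slowly varying functions, in additive form. -/
theorem eventually_forall_Icc_abs_sub_le_of_tendsto_sub {l : ℝ → ℝ} (hl : Measurable l)
    (h : ∀ t, Tendsto (fun u => l (u + t) - l u) atTop (nhds 0)) {ε : ℝ} (hε : 0 < ε) :
    ∀ᶠ u in atTop, ∀ t ∈ Icc (0 : ℝ) 1, |l (u + t) - l u| ≤ ε := by
  set φ : ℝ → ℝ → ℝ := fun u s => min 1 |l (u + s) - l u| with hφ
  have hφm : ∀ u, Measurable (φ u) := fun u => by
    simp only [hφ]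
    have : Measurable fun s => l (u + s) - l u :=
      (hl.comp (measurable_const_add u)).sub_const _
    exact measurable_const.min this.abs
  have hφ0 : ∀ u s, 0 ≤ φ u s := fun u s => le_min zero_le_one (abs_nonneg _)
  have hφ1 : ∀ u s, ‖φ u s‖ ≤ 1 := fun u s => by
    rw [Real.norm_of_nonneg (hφ0 u s)]
    exact min_le_left _ _
  have hφi : ∀ u a b, IntervalIntegrable (φ u) volume a b := fun u a b =>
    (intervalIntegrable_const (c := (1 : ℝ))).mono_fun (hφm u).aestronglyMeasurable
      (Eventually.of_forall fun s => by simpa using hφ1 u s)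
  have hF : Tendsto (fun u => ∫ s in (0 : ℝ)..2, φ u s) atTop (nhds 0) := by
    have := intervalIntegral.tendsto_integral_filter_of_dominated_convergence
      (μ := volume) (a := 0) (b := 2) (F := φ) (f := fun _ => (0 : ℝ)) (l := atTop)
      (fun _ => (1 : ℝ)) (Eventually.of_forall fun u => (hφm u).aestronglyMeasurable)
      (Eventually.of_forall fun u => Eventually.of_forall fun s _ => hφ1 u s)
      intervalIntegrable_const
      (Eventually.of_forall fun s _ => by
        have h1 : Tendsto (fun u => min 1 |l (u + s) - l u|) atTop (nhds (min 1 |(0 : ℝ)|)) :=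
          tendsto_const_nhds.min (h s).abs
        simpa [hφ] using h1)
    simpa using this
  set δ := min (1 / 2) (ε / 2) with hδ
  have hδ0 : 0 < δ := by positivity
  have hδ1 : δ ≤ 1 / 2 := min_le_left _ _
  have hδ2 : δ ≤ ε / 2 := min_le_right _ _
  obtain ⟨U, hU⟩ := eventually_atTop.1 (hF.eventually_lt_const hδ0)
  filter_upwards [eventually_ge_atTop U] with u hu t ht
  have key : min 1 |l (u + t) - l u| ≤
      (∫ s in (0 : ℝ)..2, φ u s) + ∫ s in (0 : ℝ)..2, φ (u + t) s := by
    have h1 : ∫ s in (1 : ℝ)..2, φ u s ≤ ∫ s in (0 : ℝ)..2, φ u s :=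
      intervalIntegral.integral_mono_interval zero_le_one one_le_two le_rfl
        (Eventually.of_forall fun s => hφ0 u s) (hφi _ _ _)
    have h2 : ∫ s in (1 : ℝ)..2, φ (u + t) (s - t) ≤ ∫ s in (0 : ℝ)..2, φ (u + t) s := by
      rw [intervalIntegral.integral_comp_sub_right (fun s => φ (u + t) s) t]
      exact intervalIntegral.integral_mono_interval (by linarith [ht.2]) (by linarith)
        (by linarith [ht.1]) (Eventually.of_forall fun s => hφ0 _ s) (hφi _ _ _)
    have hi2 : IntervalIntegrable (fun s => φ (u + t) (s - t)) volume 1 2 := by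
      have := (hφi (u + t) (1 - t) (2 - t)).comp_sub_right t
      simpa using this
    have h3 : ∫ s in (1 : ℝ)..2, min 1 |l (u + t) - l u| ≤
        ∫ s in (1 : ℝ)..2, (φ u s + φ (u + t) (s - t)) := by
      refine intervalIntegral.integral_mono_on one_le_two intervalIntegrable_const
        ((hφi _ _ _).add hi2) fun s _ => ?_
      simp only [hφ]
      have e : u + t + (s - t) = u + s := by ring
      rw [e]
      have tri : |l (u + t) - l u| ≤ |l (u + s) - l u| + |l (u + s) - l (u + t)| := by
        rw [add_comm |l (u + s) - l u|, abs_sub_comm (l (u + s)) (l (u + t))]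
        exact abs_sub_le _ _ _
      have a1 := abs_nonneg (l (u + s) - l u)
      have a2 := abs_nonneg (l (u + s) - l (u + t))
      rcases min_cases 1 |l (u + s) - l u| with h4 | h4 <;>
      rcases min_cases 1 |l (u + s) - l (u + t)| with h5 | h5 <;>
      rcases min_cases 1 |l (u + t) - l u| with h6 | h6 <;> linarith
    rw [intervalIntegral.integral_add (hφi _ _ _) hi2] at h3
    simp only [intervalIntegral.integral_const, smul_eq_mul] at h3
    linarith
  have k1 := hU u hu
  have k2 := hU (u + t) (by linarith [ht.1])
  rcases min_cases 1 |l (u + t) - l u| with h6 | h6 <;> linarith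

/-- Potter-type bound for slowly varying functions, in additive form. -/
theorem exists_forall_abs_sub_le_add_one_of_tendsto_sub {l : ℝ → ℝ} (hl : Measurable l)
    (h : ∀ t, Tendsto (fun u => l (u + t) - l u) atTop (nhds 0)) :
    ∃ U, ∀ u ≥ U, ∀ t ≥ 0, |l (u + t) - l u| ≤ t + 1 := by
  obtain ⟨U, hU⟩ := eventually_atTop.1
    (eventually_forall_Icc_abs_sub_le_of_tendsto_sub hl h one_pos)
  have step : ∀ n : ℕ, ∀ u ≥ U, |l (u + n) - l u| ≤ n := by
    intro n
    induction n with
    | zero => intro u _; simp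
    | succ n ih =>
      intro u hu
      have h1 := ih u hu
      have h2 := hU (u + n) (by have := n.cast_nonneg (α := ℝ); linarith) 1 (by simp)
      have h3 := abs_sub_le (l (u + n + 1)) (l (u + n)) (l u)
      push_cast
      rw [← add_assoc]
      linarith
  refine ⟨U, fun u hu t ht => ?_⟩
  have h0 := Nat.floor_le ht
  have h1 := step ⌊t⌋₊ u hu
  have h2 := hU (u + ⌊t⌋₊) (by have := ⌊t⌋₊.cast_nonneg (α := ℝ); linarith) (t - ⌊t⌋₊)
    ⟨by linarith, by linarith [Nat.lt_floor_add_one t]⟩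
  have e : u + ⌊t⌋₊ + (t - ⌊t⌋₊) = u + t := by ring
  rw [e] at h2
  have h3 := abs_sub_le (l (u + t)) (l (u + ⌊t⌋₊)) (l u)
  linarith

theorem tendsto_log_comp_exp_add_sub {M : ℝ → ℝ} (hpos : ∀ x > 1, 0 < M x)
    (hslow : ∀ t > 0, Tendsto (fun x => M (t * x) / M x) atTop (nhds 1)) (t : ℝ) :
    Tendsto (fun u => Real.log (M (Real.exp (u + t))) - Real.log (M (Real.exp u)))
      atTop (nhds 0) := by
  have h1 := ((hslow (Real.exp t) (Real.exp_pos t)).comp Real.tendsto_exp_atTop).log one_ne_zero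
  rw [Real.log_one] at h1
  refine h1.congr' ?_
  filter_upwards [eventually_gt_atTop 0, eventually_gt_atTop (-t)] with u hu hut
  have p1 := hpos _ (Real.one_lt_exp_iff.2 hu)
  have p2 := hpos (Real.exp (u + t)) (Real.one_lt_exp_iff.2 (by linarith))
  rw [← Real.log_div p2.ne' p1.ne', Function.comp_apply, ← Real.exp_add, add_comm t u]

theorem exp_log_add_log_one_add_div {h x : ℝ} (hh : 0 < h) (hx : 0 ≤ x) :
    Real.exp (Real.log h + Real.log (1 + x / h)) = h + x := by
  have : 0 < 1 + x / h := by positivity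
  rw [Real.exp_add, Real.exp_log hh, Real.exp_log this]
  field_simp

/-- A slowly varying function is asymptotically invariant under bounded shifts. -/
theorem tendsto_add_div_of_slowlyVarying {M : ℝ → ℝ} (hM : Measurable M)
    (hpos : ∀ x > 1, 0 < M x)
    (hslow : ∀ t > 0, Tendsto (fun x => M (t * x) / M x) atTop (nhds 1)) {x : ℝ} (hx : 0 ≤ x) :
    Tendsto (fun h => M (h + x) / M h) atTop (nhds 1) := by
  have hl : Measurable fun u => Real.log (M (Real.exp u)) :=
    (hM.comp Real.measurable_exp).log
  have hd : Tendsto (fun h : ℝ => Real.log (1 + x / h)) atTop (nhds 0) := by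
    have h1 : Tendsto (fun h : ℝ => 1 + x / h) atTop (nhds (1 + 0)) :=
      tendsto_const_nhds.add (tendsto_const_nhds.div_atTop tendsto_id)
    simpa using h1.log (by norm_num)
  have key : Tendsto (fun h => Real.log (M (h + x)) - Real.log (M h)) atTop (nhds 0) := by
    rw [Metric.tendsto_nhds]
    intro ε hε
    have h1 := Real.tendsto_log_atTop.eventually
      (eventually_forall_Icc_abs_sub_le_of_tendsto_sub hl
        (tendsto_log_comp_exp_add_sub hpos hslow) (half_pos hε))
    filter_upwards [h1, hd.eventually_le_const one_pos, eventually_gt_atTop 1] with h h2 h3 h4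
    have h0 : 0 < h := by linarith
    have h5 := h2 (Real.log (1 + x / h)) ⟨Real.log_nonneg (by
      have : 0 ≤ x / h := by positivity
      linarith), h3⟩
    rw [exp_log_add_log_one_add_div h0 hx, Real.exp_log h0] at h5
    rw [Real.dist_eq, sub_zero]
    linarith
  have h2 := (Real.continuous_exp.tendsto 0).comp key
  rw [Real.exp_zero] at h2
  refine h2.congr' ?_
  filter_upwards [eventually_gt_atTop 1] with h hh
  simp only [Function.comp_apply]
  rw [Real.exp_sub, Real.exp_log (hpos _ (by linarith)), Real.exp_log (hpos _ hh)]

/-- Potter-type bound for slowly varying functions. -/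
theorem exists_add_div_le_of_slowlyVarying {M : ℝ → ℝ} (hM : Measurable M)
    (hpos : ∀ x > 1, 0 < M x)
    (hslow : ∀ t > 0, Tendsto (fun x => M (t * x) / M x) atTop (nhds 1)) :
    ∃ X > 1, ∀ h ≥ X, ∀ x ≥ 0, M (h + x) / M h ≤ Real.exp 1 * (1 + x / h) := by
  have hl : Measurable fun u => Real.log (M (Real.exp u)) :=
    (hM.comp Real.measurable_exp).log
  obtain ⟨U, hU⟩ := exists_forall_abs_sub_le_add_one_of_tendsto_sub hl
    (tendsto_log_comp_exp_add_sub hpos hslow)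
  refine ⟨max 2 (Real.exp U), lt_max_of_lt_left one_lt_two, fun h hh x hx => ?_⟩
  have h1 : 2 ≤ h := (le_max_left _ _).trans hh
  have h0 : 0 < h := by linarith
  have hUh : U ≤ Real.log h := (Real.le_log_iff_exp_le h0).2 ((le_max_right _ _).trans hh)
  have hxh : 0 ≤ x / h := by positivity
  have h5 := hU _ hUh (Real.log (1 + x / h)) (Real.log_nonneg (by linarith))
  rw [exp_log_add_log_one_add_div h0 hx, Real.exp_log h0] at h5
  have h6 := Real.exp_le_exp.2 ((le_abs_self _).trans h5)
  rwa [Real.exp_sub, Real.exp_log (hpos _ (by linarith)), Real.exp_log (hpos _ (by linarith)),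
    Real.exp_add, Real.exp_log (by linarith), mul_comm] at h6

theorem rpow_le_rpow_of_le_of_abs_le {a b p q : ℝ} (ha : 1 ≤ a) (hab : a ≤ b) (hpq : |p| ≤ q) :
    a ^ p ≤ b ^ q :=
  (Real.rpow_le_rpow_of_exponent_le ha ((le_abs_self p).trans hpq)).trans
    (Real.rpow_le_rpow (by linarith) hab ((abs_nonneg p).trans hpq))

/-- Proposition (exponential decay case): if `g(x) = e^(-λx) x^(-γ) L₁(x)` for `x > 1`
with `λ > 0` and `L₁` slowly varying at infinity, then
`∫₀^∞ g(x) g(x+h) dx ~ (∫₀^∞ g(x) e^(-λx) dx) · e^(-λh) · h^(-γ) · L₁(h)` as `h → ∞`. -/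
theorem bss_acf_short_memory_asymptotics
    (lam γ : ℝ) (hlam : 0 < lam)
    (g L₁ : ℝ → ℝ)
    (hg_meas : Measurable g)
    (hg_nonneg : ∀ x ∈ Ioi (0:ℝ), 0 ≤ g x)
    (hg_int01 : IntegrableOn g (Ioc 0 1))
    (hg_exp_pos : 0 < ∫ x in Ioi (0:ℝ), g x * Real.exp (-lam * x))
    (hform : ∀ x > (1:ℝ), g x = Real.exp (-lam * x) * x ^ (-γ) * L₁ x)
    (hL₁_slow : ∀ t > (0:ℝ), Tendsto (fun x => L₁ (t * x) / L₁ x) atTop (nhds 1))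
    (hL₁_bdd : ∀ T ≥ (1:ℝ), ∃ c Cu : ℝ, 0 < c ∧ ∀ x ∈ Icc (1:ℝ) T, c ≤ L₁ x ∧ L₁ x ≤ Cu) :
    Tendsto
      (fun h => (∫ x in Ioi (0:ℝ), g x * g (x + h)) /
        ((∫ x in Ioi (0:ℝ), g x * Real.exp (-lam * x)) * Real.exp (-lam * h) *
          h ^ (-γ) * L₁ h))
      atTop (nhds 1) := by
  set M : ℝ → ℝ := fun x => g x * Real.exp (lam * x) * x ^ γ with hMdef
  have hM : Measurable M := by fun_prop
  have hML : ∀ x > 1, M x = L₁ x := fun x hx => by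
    have h0 : 0 < x := by linarith
    simp only [hMdef]
    rw [hform x hx, Real.rpow_neg h0.le, neg_mul, Real.exp_neg]
    have := (Real.rpow_pos_of_pos h0 γ).ne'
    field_simp
  have hgM : ∀ x > 1, g x = Real.exp (-lam * x) * x ^ (-γ) * M x := fun x hx => by
    rw [hML x hx, hform x hx]
  have hpos : ∀ x > 1, 0 < M x := fun x hx => by
    obtain ⟨c, C, hc, hcC⟩ := hL₁_bdd x hx.le
    rw [hML x hx]
    exact hc.trans_le (hcC x ⟨hx.le, le_rfl⟩).1
  have hslow : ∀ t > 0, Tendsto (fun x => M (t * x) / M x) atTop (nhds 1) := fun t ht => by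
    refine (hL₁_slow t ht).congr' ?_
    filter_upwards [eventually_gt_atTop 1,
      (tendsto_id.const_mul_atTop ht).eventually_gt_atTop 1] with x h1 h2
    rw [hML x h1, hML (t * x) h2]
  obtain ⟨X, hX1, hX⟩ := exists_add_div_le_of_slowlyVarying hM hpos hslow
  obtain ⟨C, hC0, hC⟩ : ∃ C > 0, ∀ x > 1, M x ≤ C * x := by
    obtain ⟨c, C, hc, hcC⟩ := hL₁_bdd X hX1.le
    have hMX := hpos X hX1
    refine ⟨max C (Real.exp 1 * M X), lt_max_of_lt_right (by positivity), fun x hx => ?_⟩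
    rcases le_total x X with h | h
    · rw [hML x hx]
      have h1 := hcC x ⟨hx.le, h⟩
      have : 0 ≤ C := by linarith
      calc L₁ x ≤ C * 1 := by linarith
        _ ≤ max C (Real.exp 1 * M X) * x := by gcongr; exact le_max_left _ _
    · have h1 := hX X le_rfl (x - X) (by linarith)
      rw [add_sub_cancel, div_le_iff₀ hMX] at h1
      have h2 : 1 + (x - X) / X = x / X := by field_simp; ring
      have h3 : x / X ≤ x := div_le_self (by linarith) hX1.le
      calc M x ≤ Real.exp 1 * (x / X) * M X := by rwa [h2] at h1
        _ ≤ Real.exp 1 * x * M X := by gcongr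
        _ = Real.exp 1 * M X * x := by ring
        _ ≤ max C (Real.exp 1 * M X) * x := by gcongr; exact le_max_right _ _
  set p := |γ| with hp
  have hp0 : 0 ≤ p := abs_nonneg _
  set B : ℝ → ℝ := fun x =>
    g x * Real.exp (-lam * x) * ((1 + x) ^ p * (Real.exp 1 * (1 + x))) with hB
  have hBm : Measurable B := by fun_prop
  have hBint : IntegrableOn B (Ioi 0) := by
    rw [← Ioc_union_Ioi_eq_Ioi zero_le_one]
    refine IntegrableOn.union ?_ ?_
    · refine (hg_int01.mul_const (2 ^ p * (Real.exp 1 * 2))).mono' hBm.aestronglyMeasurable ?_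
      refine (ae_restrict_iff' measurableSet_Ioc).2 (Eventually.of_forall fun x hx => ?_)
      have hx0 : 0 < x := hx.1
      have hg0 := hg_nonneg x hx.1
      have hB0 : 0 ≤ B x := by simp only [hB]; positivity
      rw [Real.norm_of_nonneg hB0]
      have he : Real.exp (-lam * x) ≤ 1 := Real.exp_le_one_iff.2 (by nlinarith)
      have h2 : 1 + x ≤ 2 := by linarith [hx.2]
      calc B x ≤ g x * 1 * (2 ^ p * (Real.exp 1 * 2)) := by simp only [hB]; gcongr
        _ = _ := by ring
    · have hi := integrableOn_rpow_mul_exp_neg_mul_rpow (s := p + 1 + (p + 1)) (p := 1)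
        (b := 2 * lam) (by linarith) one_pos (by positivity)
      refine ((hi.mono_set (Ioi_subset_Ioi zero_le_one)).const_mul
        (C * 2 ^ (p + 1) * Real.exp 1)).mono' hBm.aestronglyMeasurable ?_
      refine (ae_restrict_iff' measurableSet_Ioi).2 (Eventually.of_forall fun x hx => ?_)
      have hx1 : 1 < x := hx
      have hx0 : 0 < x := by linarith
      have hg0 := hg_nonneg x hx0
      have hB0 : 0 ≤ B x := by simp only [hB]; positivity
      rw [Real.norm_of_nonneg hB0]
      have h1 : x ^ (-γ) ≤ x ^ p := rpow_le_rpow_of_le_of_abs_le hx1.le le_rfl (by rw [abs_neg])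
      have h2 : 1 + x ≤ 2 * x := by linarith
      have hMx := hpos x hx1
      calc B x = Real.exp (-lam * x) * x ^ (-γ) * M x * Real.exp (-lam * x) *
            ((1 + x) ^ p * (Real.exp 1 * (1 + x))) := by simp only [hB]; rw [hgM x hx1]
        _ ≤ Real.exp (-lam * x) * x ^ p * (C * x) * Real.exp (-lam * x) *
            ((2 * x) ^ p * (Real.exp 1 * (2 * x))) := by
          gcongr
          exact hC x hx1
        _ = _ := by
          rw [Real.rpow_one, Real.mul_rpow zero_le_two hx0.le, Real.rpow_add hx0 (p + 1),
            Real.rpow_add_one hx0.ne', Real.rpow_add_one two_ne_zero,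
            show -(2 * lam) * x = -lam * x + -lam * x by ring, Real.exp_add]
          ring
  set D : ℝ → ℝ := fun h => Real.exp (-lam * h) * h ^ (-γ) * L₁ h with hD
  have hK : ∀ h > 1, ∀ x ≥ 0, g x * g (x + h) / D h =
      g x * Real.exp (-lam * x) * ((1 + x / h) ^ (-γ) * (M (h + x) / M h)) := by
    intro h hh x hx
    have h0 : 0 < h := by linarith
    have hMh := (hpos h hh).ne'
    have e1 : h + x = h * (1 + x / h) := by field_simp
    have e2 : (h + x) ^ (-γ) = h ^ (-γ) * (1 + x / h) ^ (-γ) := by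
      rw [← Real.mul_rpow h0.le (by positivity), ← e1]
    have hr := (Real.rpow_pos_of_pos h0 (-γ)).ne'
    simp only [hD]
    rw [← hML h hh, add_comm x h, hgM (h + x) (by linarith), e2, mul_add, Real.exp_add]
    field_simp
  have hlim : Tendsto (fun h => ∫ x in Ioi (0 : ℝ), g x * g (x + h) / D h) atTop
      (nhds (∫ x in Ioi (0 : ℝ), g x * Real.exp (-lam * x))) := by
    refine tendsto_integral_filter_of_dominated_convergence B ?_ ?_ hBint ?_
    · exact Eventually.of_forall fun h => Measurable.aestronglyMeasurable (by fun_prop)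
    · filter_upwards [eventually_ge_atTop X] with h hh
      refine (ae_restrict_iff' measurableSet_Ioi).2 (Eventually.of_forall fun x hx => ?_)
      have hx0 : 0 < x := hx
      have hh1 : 1 < h := by linarith
      have hh0 : 0 < h := by linarith
      rw [hK h hh1 x hx0.le]
      have hg0 := hg_nonneg x hx0
      have hM1 := hpos h hh1
      have hM2 := hpos (h + x) (by linarith)
      have hd : x / h ≤ x := div_le_self hx0.le hh1.le
      have hd0 : 0 ≤ x / h := by positivity
      have h1 : (1 + x / h) ^ (-γ) ≤ (1 + x) ^ p :=
        rpow_le_rpow_of_le_of_abs_le (by linarith) (by linarith) (by rw [abs_neg])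
      have h2 : M (h + x) / M h ≤ Real.exp 1 * (1 + x) :=
        (hX h hh x hx0.le).trans (by gcongr)
      rw [Real.norm_of_nonneg (by positivity)]
      simp only [hB]
      gcongr
    · refine (ae_restrict_iff' measurableSet_Ioi).2 (Eventually.of_forall fun x hx => ?_)
      have hx0 : 0 < x := hx
      have h1 : Tendsto (fun h : ℝ => 1 + x / h) atTop (nhds (1 + 0)) :=
        tendsto_const_nhds.add (tendsto_const_nhds.div_atTop tendsto_id)
      have h2 := h1.rpow_const (p := -γ) (Or.inl (by norm_num))
      have h3 := (h2.mul (tendsto_add_div_of_slowlyVarying hM hpos hslow hx0.le)).const_mul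
        (g x * Real.exp (-lam * x))
      simp only [add_zero, Real.one_rpow, mul_one] at h3
      refine h3.congr' ?_
      filter_upwards [eventually_gt_atTop 1] with h hh
      rw [hK h hh x hx0.le]
  have hfin := hlim.div_const (∫ x in Ioi (0 : ℝ), g x * Real.exp (-lam * x))
  rw [div_self hg_exp_pos.ne'] at hfin
  refine hfin.congr fun h => ?_
  rw [integral_div, div_div]
  congr 1
  simp only [hD]
  ring
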